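/- arXiv:1603.08569 — 2 statements merged into one kernel-verified Lean document; each statement's English description precedes it below -/
import Mathlib

section
/- Let G be a finite group, A a finite intersection-closed collection of normal subgroups of G containing {1} and G. Then every supercharacter χ^{N•} of the normal supercharacter theory generated by A is integral, i.e., χ^{N•}(g) ∈ ℚ for all g ∈ G. -/
open CategoryTheory
open scoped Classical BigOperators

/-- The set of irreducible complex characters of `G`. -/
def Irr (G : Type) [Group G] : Set (G → ℂ) :=
  {f | ∃ V : FDRep ℂ G, Simple V ∧ V.character = f}

/-- The kernel of a character, `{g : G | χ g = χ 1}`. -/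
def charKer {G : Type} [Group G] (f : G → ℂ) : Set G := {g | f g = f 1}

/-- `N° = N \ ⋃ {H ∈ A : H ⊊ N}`. -/
def Ncirc {G : Type} [Group G] (A : Set (Subgroup G)) (N : Subgroup G) : Set G :=
  (N : Set G) \ ⋃ H ∈ {H | H ∈ A ∧ H < N}, (H : Set G)

/-- `X^N`, the irreducible characters whose kernel contains `N`. -/
def XN {G : Type} [Group G] (N : Subgroup G) : Set (G → ℂ) :=
  {ψ ∈ Irr G | (N : Set G) ⊆ charKer ψ}

/-- `X^{N•} = X^N \ ⋃ {X^K : K ∈ A, N ⊊ K}`. -/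
def XNbullet {G : Type} [Group G] (A : Set (Subgroup G)) (N : Subgroup G) : Set (G → ℂ) :=
  XN N \ ⋃ K ∈ {K | K ∈ A ∧ N < K}, XN K

/-- `χ^N = Σ_{ψ ∈ X^N} ψ(1) ψ`. -/
noncomputable def chiN {G : Type} [Group G] (N : Subgroup G) : G → ℂ :=
  fun g => ∑ᶠ ψ ∈ XN N, ψ 1 * ψ g

/-- `χ^{N•} = Σ_{ψ ∈ X^{N•}} ψ(1) ψ`. -/
noncomputable def chiNbullet {G : Type} [Group G] (A : Set (Subgroup G)) (N : Subgroup G) :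
    G → ℂ :=
  fun g => ∑ᶠ ψ ∈ XNbullet A N, ψ 1 * ψ g

/-- `N°` taken with respect to the set of all normal subgroups of `G`. -/
def NcircAll {G : Type} [Group G] (N : Subgroup G) : Set G :=
  (N : Set G) \ ⋃ H ∈ {H : Subgroup G | H.Normal ∧ H < N}, (H : Set G)

/-- `[g] = {h : h^G = g^G}` where `h^G` is the normal closure of `h`. -/
def closureClass {G : Type} [Group G] (g : G) : Set G :=
  {h | Subgroup.normalClosure {h} = Subgroup.normalClosure {g}}

/-- `E_g`, the irreducible characters not containing `g` in their kernel. -/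
def Eg {G : Type} [Group G] (g : G) : Set (G → ℂ) :=
  {χ ∈ Irr G | χ g ≠ χ 1}

/-- `K_g = ⋃ {C_h : E_h = E_g}`. -/
def Kg {G : Type} [Group G] (g : G) : Set G :=
  {x | ∃ h : G, Eg h = Eg g ∧ IsConj h x}

/-- Automorphisms of a field extend to algebraically closed extensions. -/
theorem IsAlgClosed.exists_ringEquiv_extending {K L : Type*} [Field K] [Field L] [Algebra K L]
    [IsAlgClosed L] (e : K ≃+* K) :
    ∃ σ : L ≃+* L, ∀ k, σ (algebraMap K L k) = algebraMap K L (e k) := by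
  obtain ⟨s, hs⟩ := exists_isTranscendenceBasis K L
  have := IsAlgClosed.isAlgClosure_of_transcendence_basis _ hs
  let f := (hs.1.aevalEquiv.symm.toRingEquiv.trans (MvPolynomial.mapEquiv s e)).trans
    hs.1.aevalEquiv.toRingEquiv
  have hf : ∀ k, f (algebraMap K _ k) = algebraMap K _ (e k) := by
    intro k
    change hs.1.aevalEquiv (MvPolynomial.map (e : K →+* K)
      (hs.1.aevalEquiv.symm (algebraMap K _ k))) = _
    rw [AlgEquiv.commutes, MvPolynomial.algebraMap_eq, MvPolynomial.map_C,
      ← MvPolynomial.algebraMap_eq, AlgEquiv.commutes]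
    rfl
  refine ⟨IsAlgClosure.equivOfEquiv L L f, fun k => ?_⟩
  have h := IsAlgClosure.equivOfEquiv_algebraMap L L f (algebraMap K _ k)
  rwa [hf] at h

/-- An algebraic complex number fixed by every field automorphism of `ℂ` is rational. -/
theorem exists_rat_eq_of_forall_ringEquiv_eq {x : ℂ} (hx : IsAlgebraic ℚ x)
    (hfix : ∀ σ : ℂ ≃+* ℂ, σ x = x) : ∃ q : ℚ, x = (q : ℂ) := by
  have : IsAlgClosure ℚ (algebraicClosure ℚ ℂ) := algebraicClosure.isAlgClosure ℚ ℂ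
  have : IsGalois ℚ (algebraicClosure ℚ ℂ) := IsAlgClosure.isGalois ℚ _
  let y : algebraicClosure ℚ ℂ := ⟨x, mem_algebraicClosure_iff.2 hx⟩
  have hy : ∀ e : algebraicClosure ℚ ℂ ≃ₐ[ℚ] algebraicClosure ℚ ℂ, e y = y := by
    intro e
    obtain ⟨σ, hσ⟩ := IsAlgClosed.exists_ringEquiv_extending (L := ℂ) e.toRingEquiv
    exact Subtype.ext ((hσ y).symm.trans (hfix σ))
  obtain ⟨q, hq⟩ := (InfiniteGalois.mem_range_algebraMap_iff_fixed y).2 hy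
  exact ⟨q, by simpa [y] using (congrArg Subtype.val hq).symm⟩

/-- The trace of a complex matrix of finite order is algebraic. -/
theorem isAlgebraic_trace_of_pow_eq_one {ι : Type*} [Fintype ι] [DecidableEq ι] {M : Matrix ι ι ℂ}
    {n : ℕ} (hn : n ≠ 0) (hM : M ^ n = 1) : IsAlgebraic ℚ M.trace := by
  rw [Matrix.trace_eq_sum_roots_charpoly]
  refine Multiset.sum_induction (IsAlgebraic ℚ) _ (fun _ _ => IsAlgebraic.add) isAlgebraic_zero ?_
  intro μ hμ
  have hev : Module.End.HasEigenvalue (Matrix.toLin' M) μ := by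
    rw [Module.End.hasEigenvalue_iff_isRoot_charpoly, Matrix.charpoly_toLin']
    exact Polynomial.isRoot_of_mem_roots hμ
  obtain ⟨v, hv⟩ := hev.exists_hasEigenvector
  have hpow : μ ^ n = 1 := by
    have h := hv.pow_apply n
    rw [← Matrix.toLin'_pow, hM, Matrix.toLin'_one, LinearMap.id_apply] at h
    exact (smul_left_injective ℂ hv.2 (by simpa using h)).symm
  exact (IsIntegral.of_pow (Nat.pos_of_ne_zero hn) (hpow ▸ isIntegral_one)).isAlgebraic

/-- The matrix representation afforded by `V` in a chosen basis. -/
noncomputable def FDRep.toMatrixHom {G : Type} [Group G] (V : FDRep ℂ G) :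
    G →* Matrix (Fin (Module.finrank ℂ V)) (Fin (Module.finrank ℂ V)) ℂ :=
  (LinearMap.toMatrixAlgEquiv (Module.finBasis ℂ V) : (V →ₗ[ℂ] V) →* _).comp V.ρ

theorem FDRep.trace_toMatrixHom {G : Type} [Group G] (V : FDRep ℂ G) (g : G) :
    (V.toMatrixHom g).trace = V.character g :=
  (LinearMap.trace_eq_matrix_trace ℂ (Module.finBasis ℂ V) (V.ρ g)).symm

/-- The Galois twist of `V` by an automorphism of `ℂ`. -/
noncomputable def FDRep.twist {G : Type} [Group G] (σ : ℂ ≃+* ℂ) (V : FDRep ℂ G) : FDRep ℂ G :=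
  FDRep.of <| (MonoidHomClass.toMonoidHom
      (Matrix.toLinAlgEquiv' (R := ℂ) (n := Fin (Module.finrank ℂ V)))).comp
    ((σ : ℂ →+* ℂ).mapMatrix.toMonoidHom.comp V.toMatrixHom)

theorem FDRep.character_twist {G : Type} [Group G] (σ : ℂ ≃+* ℂ) (V : FDRep ℂ G) :
    (V.twist σ).character = σ ∘ V.character := by
  ext g
  rw [Function.comp_apply, ← V.trace_toMatrixHom]
  change LinearMap.trace ℂ _ (Matrix.toLin' ((V.toMatrixHom g).map σ)) = _
  rw [Matrix.trace_toLin'_eq]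
  simp [Matrix.trace]

theorem isAlgebraic_of_mem_Irr {G : Type} [Group G] [Finite G] {ψ : G → ℂ} (hψ : ψ ∈ Irr G)
    (g : G) : IsAlgebraic ℚ (ψ g) := by
  obtain ⟨V, -, rfl⟩ := hψ
  rw [← V.trace_toMatrixHom]
  refine isAlgebraic_trace_of_pow_eq_one (n := Nat.card G) Nat.card_pos.ne' ?_
  rw [← map_pow, pow_card_eq_one', map_one]

theorem comp_mem_Irr {G : Type} [Group G] [Fintype G] (σ : ℂ ≃+* ℂ) {ψ : G → ℂ}
    (hψ : ψ ∈ Irr G) : σ ∘ ψ ∈ Irr G := by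
  obtain ⟨V, hV, rfl⟩ := hψ
  refine ⟨V.twist σ, ?_, V.character_twist σ⟩
  rw [FDRep.simple_iff_char_is_norm_one] at hV ⊢
  simpa [FDRep.character_twist] using congrArg σ hV

theorem comp_mem_Irr_iff {G : Type} [Group G] [Fintype G] (σ : ℂ ≃+* ℂ) {ψ : G → ℂ} :
    σ ∘ ψ ∈ Irr G ↔ ψ ∈ Irr G := by
  refine ⟨fun h => ?_, comp_mem_Irr σ⟩
  have h' := comp_mem_Irr σ.symm h
  rwa [← Function.comp_assoc, show σ.symm ∘ σ = id from σ.symm_comp_self, Function.id_comp] at h'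

theorem comp_mem_XN_iff {G : Type} [Group G] [Fintype G] (σ : ℂ ≃+* ℂ) {N : Subgroup G}
    {ψ : G → ℂ} : σ ∘ ψ ∈ XN N ↔ ψ ∈ XN N := by
  simp [XN, charKer, comp_mem_Irr_iff]

theorem comp_mem_XNbullet_iff {G : Type} [Group G] [Fintype G] (σ : ℂ ≃+* ℂ)
    {A : Set (Subgroup G)} {N : Subgroup G} {ψ : G → ℂ} :
    σ ∘ ψ ∈ XNbullet A N ↔ ψ ∈ XNbullet A N := by
  simp [XNbullet, comp_mem_XN_iff]

theorem map_chiNbullet {G : Type} [Group G] [Fintype G] (σ : ℂ ≃+* ℂ) (A : Set (Subgroup G))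
    (N : Subgroup G) (g : G) : σ (chiNbullet A N g) = chiNbullet A N g := by
  have hσ := AddEquiv.map_finsum σ.toAddEquiv
    (fun ψ : G → ℂ => ∑ᶠ _ : ψ ∈ XNbullet A N, ψ 1 * ψ g)
  refine hσ.trans (finsum_eq_of_bijective (σ ∘ ·) ((Equiv.refl G).arrowCongr σ.toEquiv).bijective ?_)
  intro ψ
  rw [AddEquiv.map_finsum]
  simp [comp_mem_XNbullet_iff]


theorem stmt_8 {G : Type} [Group G] [Fintype G] (A : Set (Subgroup G)) (hfin : A.Finite)
    (hnorm : ∀ N ∈ A, N.Normal) (hbot : ⊥ ∈ A) (htop : ⊤ ∈ A)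
    (hint : ∀ N ∈ A, ∀ H ∈ A, N ⊓ H ∈ A)
    (N : Subgroup G) (hNA : N ∈ A) (g : G) :
    ∃ q : ℚ, chiNbullet A N g = (q : ℂ) := by
  refine exists_rat_eq_of_forall_ringEquiv_eq ?_ fun σ => map_chiNbullet σ A N g
  refine finsum_mem_induction (IsAlgebraic ℚ) isAlgebraic_zero (fun _ _ => IsAlgebraic.add) ?_
  intro ψ hψ
  exact (isAlgebraic_of_mem_Irr hψ.1.1 1).mul (isAlgebraic_of_mem_Irr hψ.1.1 g)
end

section
/- Let G be a finite group, N ⊴ G, and let S be the set of all normal subgroups of G. For g ∈ G define E_g = {χ ∈ Irr(G) : χ(g)/χ(1) ≠ 1} (the set of irreducible characters not containing g in their kernel), and K_g = ⋃{C_h : E_h = E_g} where C_h is the conjugacy class of h. If N° ≠ ∅ (with ° taken over all normal subgroups), then for every g ∈ N°, K_g = N°. -/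
open CategoryTheory
open scoped Classical BigOperators

/-- Complex numbers of norm one whose sum equals their number are all equal to one. -/
theorem Multiset.eq_one_of_sum_eq_card {s : Multiset ℂ} (hs : ∀ z ∈ s, ‖z‖ = 1)
    (hsum : s.sum = s.card) : ∀ z ∈ s, z = 1 := by
  have hre : ∀ z ∈ s, z.re ≤ 1 := fun z hz => hs z hz ▸ Complex.re_le_norm z
  have hsum_re : (s.map Complex.re).sum = s.card := by
    have h := congrArg Complex.re hsum
    rw [← Complex.coe_reAddGroupHom, map_multiset_sum] at h
    simpa using h
  intro z hz
  have hz1 : z.re = 1 := by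
    by_contra hne
    have hlt : (s.map Complex.re).sum < (s.map fun _ => (1 : ℝ)).sum :=
      Multiset.sum_lt_sum hre ⟨z, hz, lt_of_le_of_ne (hre z hz) hne⟩
    rw [hsum_re] at hlt
    simp at hlt
  have hnorm := Complex.sq_norm z
  rw [hs z hz, Complex.normSq_apply, hz1] at hnorm
  have him : z.im = 0 := by nlinarith
  exact Complex.ext hz1 him

/-- An endomorphism of finite order of a finite-dimensional complex vector space whose trace is the
dimension is the identity. -/
theorem Module.End.eq_one_of_pow_eq_one_of_trace_eq_finrank {V : Type*} [AddCommGroup V]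
    [Module ℂ V] [FiniteDimensional ℂ V] {f : Module.End ℂ V} {n : ℕ} (hn : n ≠ 0)
    (hf : f ^ n = 1) (htr : LinearMap.trace ℂ V f = Module.finrank ℂ V) : f = 1 := by
  have hsplits : f.charpoly.Splits := IsAlgClosed.splits _
  have hcard : f.charpoly.roots.card = Module.finrank ℂ V := by
    rw [← hsplits.natDegree_eq_card_roots, LinearMap.charpoly_natDegree]
  have hnorm : ∀ z ∈ f.charpoly.roots, ‖z‖ = 1 := by
    intro z hz
    have hz' : f.HasEigenvalue z :=
      (Module.End.hasEigenvalue_iff_isRoot_charpoly f z).2 (Polynomial.isRoot_of_mem_roots hz)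
    obtain ⟨v, hv⟩ := hz'.exists_hasEigenvector
    have hpow := hv.pow_apply n
    rw [hf, Module.End.one_apply] at hpow
    have hzn : z ^ n = 1 := by
      have h0 : (z ^ n - 1) • v = 0 := by rw [sub_smul, one_smul, ← hpow, sub_self]
      exact sub_eq_zero.1 ((smul_eq_zero.1 h0).resolve_right hv.2)
    exact Complex.norm_eq_one_of_pow_eq_one hzn hn
  have hone : ∀ z ∈ f.charpoly.roots, z = 1 :=
    Multiset.eq_one_of_sum_eq_card hnorm <| by
      rw [← Module.End.trace_eq_sum_roots_charpoly_of_splits hsplits, htr, hcard]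
  have hchar : f.charpoly = (Polynomial.X - Polynomial.C 1) ^ Module.finrank ℂ V := by
    rw [hsplits.eq_prod_roots_of_monic f.charpoly_monic, Multiset.eq_replicate_of_mem hone, hcard]
    simp
  have hnil : IsNilpotent (f - 1) := by
    refine ⟨Module.finrank ℂ V, ?_⟩
    have h := f.aeval_self_charpoly
    rw [hchar] at h
    simpa using h
  have hss : f.IsSemisimple := by
    refine Module.End.isSemisimple_of_squarefree_aeval_eq_zero
      (p := Polynomial.X ^ n - Polynomial.C 1) ?_ (by simp [hf])
    exact (Polynomial.separable_X_pow_sub_C 1 (Nat.cast_ne_zero.2 hn) one_ne_zero).squarefree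
  have hss1 : (f - 1).IsSemisimple := by
    have h := hss.aeval (Polynomial.X - Polynomial.C 1)
    simpa using h
  exact sub_eq_zero.1 (Module.End.eq_zero_of_isNilpotent_isSemisimple hnil hss1)

/-- An element of a finite group lies in the kernel of a character exactly when it acts trivially. -/
theorem FDRep.character_eq_character_one_iff {G : Type*} [Group G] [Finite G] (V : FDRep ℂ G)
    (g : G) : V.character g = V.character 1 ↔ V.ρ g = 1 := by
  constructor
  · intro h
    rw [FDRep.char_one] at h
    refine Module.End.eq_one_of_pow_eq_one_of_trace_eq_finrank (n := Nat.card G)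
      Nat.card_pos.ne' ?_ h
    rw [← map_pow, pow_card_eq_one', map_one]
  · intro h
    simp only [FDRep.character, h, map_one V.ρ]

/-- The `FDRep` of an irreducible complex representation of a finite group is simple. -/
theorem FDRep.simple_of_isIrreducible {G V : Type} [Group G] [Finite G] [AddCommGroup V]
    [Module ℂ V] [FiniteDimensional ℂ V] (ρ : Representation ℂ G V) [ρ.IsIrreducible] :
    Simple (FDRep.of ρ) := by
  have := Fintype.ofFinite G
  have hcard : (Nat.card G : ℂ) ≠ 0 := Nat.cast_ne_zero.2 Nat.card_pos.ne'
  have := invertibleOfNonzero hcard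
  rw [FDRep.simple_iff_char_is_norm_one]
  have h := Representation.char_orthonormal ρ ρ
  rw [if_pos ⟨Representation.Equiv.refl ρ⟩, inv_mul_eq_one₀ hcard] at h
  exact h.symm

/-- A simple module over the complex group algebra of a finite group gives rise to a simple
`FDRep` with the same elements acting trivially. -/
theorem exists_simple_fdRep_of_isSimpleModule {G : Type} [Group G] [Finite G] (M : Type)
    [AddCommGroup M] [Module (MonoidAlgebra ℂ G) M] [IsSimpleModule (MonoidAlgebra ℂ G) M] :
    ∃ W : FDRep ℂ G, Simple W ∧
      ∀ g, W.ρ g = 1 ↔ ∀ x : M, MonoidAlgebra.single g (1 : ℂ) • x = x := by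
  let := Module.compHom M (algebraMap ℂ (MonoidAlgebra ℂ G))
  have : IsScalarTower ℂ (MonoidAlgebra ℂ G) M := .of_algebraMap_smul fun _ _ => rfl
  have : FiniteDimensional ℂ M := Module.Finite.trans (MonoidAlgebra ℂ G) M
  let σ : Representation ℂ G M := Representation.ofModule' M
  have hσ : σ.asAlgebraHom = Algebra.lsmul ℂ ℂ M := Equiv.apply_symm_apply _ _
  let e : σ.asModule ≃ₗ[MonoidAlgebra ℂ G] M :=
    { σ.asModuleEquiv with
      map_smul' := fun r x =>
        (σ.asModuleEquiv_map_smul r x).trans (by rw [hσ]; rfl) }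
  have : σ.IsIrreducible :=
    (Representation.irreducible_iff_isSimpleModule_asModule σ).2 (IsSimpleModule.congr e)
  exact ⟨FDRep.of σ, FDRep.simple_of_isIrreducible σ, fun g => LinearMap.ext_iff⟩

/-- If `h` acts non-trivially in a complex representation `ρ` of a finite group, then it acts
non-trivially in some simple representation in which the kernel of `ρ` acts trivially. -/
theorem Representation.exists_simple_fdRep_ne_one {G V : Type} [Group G] [Finite G]
    [AddCommGroup V] [Module ℂ V] (ρ : Representation ℂ G V) {h : G} (hh : ρ h ≠ 1) :
    ∃ W : FDRep ℂ G, Simple W ∧ (∀ n, ρ n = 1 → W.ρ n = 1) ∧ W.ρ h ≠ 1 := by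
  have : NeZero (Nat.card G : ℂ) := ⟨Nat.cast_ne_zero.2 Nat.card_pos.ne'⟩
  obtain ⟨S, hS, x, hx, hne⟩ : ∃ S : Submodule (MonoidAlgebra ℂ G) ρ.asModule,
      IsSimpleModule (MonoidAlgebra ℂ G) S ∧
        ∃ x ∈ S, MonoidAlgebra.single h (1 : ℂ) • x ≠ x := by
    by_contra! hall
    refine hh (LinearMap.ext fun v => ?_)
    have hfix : ∀ w : ρ.asModule, MonoidAlgebra.single h (1 : ℂ) • w = w := by
      intro w
      have hw : w ∈ sSup {S : Submodule (MonoidAlgebra ℂ G) ρ.asModule |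
          IsSimpleModule (MonoidAlgebra ℂ G) S} := by
        rw [IsSemisimpleModule.sSup_simples_eq_top]
        trivial
      rw [sSup_eq_iSup'] at hw
      induction hw using Submodule.iSup_induction' with
      | mem S x hx => exact hall S.1 S.2 x hx
      | zero => exact smul_zero _
      | add x y _ _ hx hy => rw [smul_add, hx, hy]
    have hv := hfix (ρ.asModuleEquiv.symm v)
    rw [Representation.single_smul, one_smul] at hv
    exact hv
  obtain ⟨W, hW, hact⟩ := exists_simple_fdRep_of_isSimpleModule (G := G) S
  refine ⟨W, hW, fun n hn => (hact n).2 fun y => Subtype.ext ?_, fun h1 => hne ?_⟩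
  · change MonoidAlgebra.single n (1 : ℂ) • (y : ρ.asModule) = y
    rw [Representation.single_smul, hn, one_smul]
    rfl
  · exact congrArg Subtype.val ((hact h).1 h1 ⟨x, hx⟩)

/-- A normal subgroup of a finite group is cut out by the irreducible characters whose kernel
contains it. -/
theorem exists_mem_XN_apply_ne {G : Type} [Group G] [Finite G] (N : Subgroup G) [N.Normal] {h : G}
    (hh : h ∉ N) : ∃ χ ∈ XN N, χ h ≠ χ 1 := by
  let ρ : Representation ℂ G (MonoidAlgebra ℂ (G ⧸ N)) := Representation.ofMulAction ℂ G (G ⧸ N)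
  have hρ : ρ h ≠ 1 := by
    intro h1
    have h2 := LinearMap.congr_fun h1 (MonoidAlgebra.single (1 : G ⧸ N) (1 : ℂ))
    rw [Representation.ofMulAction_single, Module.End.one_apply] at h2
    have h3 : h • (1 : G ⧸ N) = 1 := MonoidAlgebra.single_left_injective one_ne_zero h2
    rw [← QuotientGroup.mk_one, MulAction.Quotient.smul_mk, smul_eq_mul, mul_one] at h3
    exact hh ((QuotientGroup.eq_one_iff h).1 h3)
  obtain ⟨W, hW, hN, hne⟩ := ρ.exists_simple_fdRep_ne_one hρ
  refine ⟨W.character, ⟨⟨W, hW, rfl⟩, fun n hn => ?_⟩, fun h1 => hne ?_⟩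
  · refine (W.character_eq_character_one_iff n).2 (hN n ?_)
    refine MonoidAlgebra.lhom_ext' fun q => LinearMap.ext_ring ?_
    induction q using QuotientGroup.induction_on with
    | H q =>
      have hq : n • (q : G ⧸ N) = q := by
        rw [MulAction.Quotient.smul_mk, smul_eq_mul, QuotientGroup.eq]
        have := Subgroup.Normal.conj_mem ‹N.Normal› n⁻¹ (N.inv_mem hn) q⁻¹
        simpa [mul_assoc] using this
      change ρ n (MonoidAlgebra.single _ 1) = MonoidAlgebra.single _ 1
      rw [Representation.ofMulAction_single, hq]
  · exact (W.character_eq_character_one_iff h).1 h1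

/-- The irreducible characters of a finite group that contain `g` in their kernel are those that
contain the normal closure of `g`. -/
theorem mem_XN_normalClosure_iff {G : Type} [Group G] [Finite G] {g : G} {χ : G → ℂ} :
    χ ∈ XN (Subgroup.normalClosure {g}) ↔ χ ∈ Irr G ∧ χ g = χ 1 := by
  constructor
  · exact fun h => ⟨h.1, h.2 (Subgroup.subset_normalClosure rfl)⟩
  · rintro ⟨hχ, hg⟩
    refine ⟨hχ, fun x hx => ?_⟩
    obtain ⟨V, -, rfl⟩ := hχ
    refine (V.character_eq_character_one_iff x).2 ?_
    have hle : Subgroup.normalClosure {g} ≤ MonoidHom.ker V.ρ := by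
      refine Subgroup.normalClosure_le_normal ?_
      rintro _ rfl
      exact (V.character_eq_character_one_iff _).1 hg
    exact hle hx

/-- If every irreducible character with `g` in its kernel has `h` in its kernel, then `h` lies in
the normal closure of `g`. -/
theorem mem_normalClosure_of_Eg_subset {G : Type} [Group G] [Finite G] {g h : G}
    (hsub : Eg h ⊆ Eg g) : h ∈ Subgroup.normalClosure {g} := by
  by_contra hh
  obtain ⟨χ, hχ, hne⟩ := exists_mem_XN_apply_ne _ hh
  exact (hsub ⟨hχ.1, hne⟩).2 (mem_XN_normalClosure_iff.1 hχ).2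

/-- In a finite group `E_h = E_g` exactly when `h` and `g` have the same normal closure. -/
theorem Eg_eq_Eg_iff {G : Type} [Group G] [Finite G] {g h : G} :
    Eg h = Eg g ↔ Subgroup.normalClosure {h} = Subgroup.normalClosure {g} := by
  constructor
  · intro heq
    refine le_antisymm (Subgroup.normalClosure_le_normal ?_) (Subgroup.normalClosure_le_normal ?_)
    · exact Set.singleton_subset_iff.2 (mem_normalClosure_of_Eg_subset heq.subset)
    · exact Set.singleton_subset_iff.2 (mem_normalClosure_of_Eg_subset heq.superset)
  · intro heq
    ext χ
    refine and_congr_right fun hχ => not_congr ?_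
    have h1 := mem_XN_normalClosure_iff (g := h) (χ := χ)
    rw [heq, mem_XN_normalClosure_iff] at h1
    simpa [hχ] using h1.symm

/-- The elements of `N°` are those whose normal closure is `N`. -/
theorem mem_NcircAll_iff {G : Type} [Group G] {N : Subgroup G} [N.Normal] {g : G} :
    g ∈ NcircAll N ↔ Subgroup.normalClosure {g} = N := by
  simp only [NcircAll, Set.mem_sdiff, SetLike.mem_coe, Set.mem_iUnion, Set.mem_ofPred_eq,
    exists_prop, not_exists, not_and]
  constructor
  · rintro ⟨hg, hmin⟩
    have hle : Subgroup.normalClosure {g} ≤ N :=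
      Subgroup.normalClosure_le_normal (Set.singleton_subset_iff.2 hg)
    by_contra hne
    exact hmin _ ⟨Subgroup.normalClosure_normal, lt_of_le_of_ne hle hne⟩
      (Subgroup.subset_normalClosure rfl)
  · rintro rfl
    refine ⟨Subgroup.subset_normalClosure rfl, fun H hH hgH => ?_⟩
    have := hH.1
    exact hH.2.not_ge (Subgroup.normalClosure_le_normal (Set.singleton_subset_iff.2 hgH))

/-- Conjugate elements have the same normal closure. -/
theorem IsConj.normalClosure_eq {G : Type*} [Group G] {g h : G} (hgh : IsConj g h) :
    Subgroup.normalClosure {g} = Subgroup.normalClosure {h} := by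
  have key : ∀ {a b : G}, IsConj a b → Subgroup.normalClosure {b} ≤ Subgroup.normalClosure {a} := by
    intro a b hab
    obtain ⟨c, rfl⟩ := isConj_iff.1 hab
    refine Subgroup.normalClosure_le_normal (Set.singleton_subset_iff.2 ?_)
    exact Subgroup.normalClosure_normal.conj_mem a (Subgroup.subset_normalClosure (Set.mem_singleton a)) c
  exact le_antisymm (key hgh.symm) (key hgh)

theorem stmt_17 {G : Type} [Group G] [Fintype G] (N : Subgroup G) (hN : N.Normal)
    (g : G) (hg : g ∈ NcircAll N) : Kg g = NcircAll N := by
  have hgN := mem_NcircAll_iff.1 hg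
  ext x
  rw [mem_NcircAll_iff]
  constructor
  · rintro ⟨h, hh, hx⟩
    rw [← hx.normalClosure_eq, Eg_eq_Eg_iff.1 hh, hgN]
  · intro hx
    exact ⟨x, Eg_eq_Eg_iff.2 (hx.trans hgN.symm), IsConj.refl x⟩
end
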